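/- The Minkowski sum (Σ+C)_{n,2d} = Σ_{n,2d} + C_{n,2d} is a proper cone in H_{n,2d}: it is a convex cone that is closed, pointed, and has nonempty interior. -/

import Mathlib

open MvPolynomial

/-- Embed an exponent vector into `ℝⁿ`. -/
def expToVec {n : ℕ} (α : Fin n →₀ ℕ) : Fin n → ℝ := fun i => (α i : ℝ)

/-- `h` is a nonnegative circuit form of degree `d` in `n` variables: it is
homogeneous of degree `d`, nonnegative, its support consists of a set `S` of
affinely independent even exponent vectors with positive coefficients
(the outer terms), possibly together with one additional exponent `β` lying in
the relative interior of the convex hull of `S` (the inner term). -/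
def IsNonnegCircuit {n : ℕ} (d : ℕ) (h : MvPolynomial (Fin n) ℝ) : Prop :=
  h.IsHomogeneous d ∧ (∀ x : Fin n → ℝ, 0 ≤ eval x h) ∧
  ∃ S : Finset (Fin n →₀ ℕ),
    (∀ α ∈ S, (∀ i, Even (α i)) ∧ 0 < coeff α h) ∧
    AffineIndependent ℝ (fun a : {α : (Fin n →₀ ℕ) // α ∈ S} => expToVec a.1) ∧
    ((h.support : Set (Fin n →₀ ℕ)) = ↑S ∨
      ∃ β : Fin n →₀ ℕ, β ∉ S ∧ (h.support : Set (Fin n →₀ ℕ)) = insert β ↑S ∧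
        expToVec β ∈ intrinsicInterior ℝ (convexHull ℝ (expToVec '' ↑S)))

/-- `f` is a sum of squares of forms of degree `d` (hence a form of degree `2d`). -/
def IsSOSForm {n : ℕ} (d : ℕ) (f : MvPolynomial (Fin n) ℝ) : Prop :=
  ∃ (k : ℕ) (g : Fin k → MvPolynomial (Fin n) ℝ),
    (∀ i, (g i).IsHomogeneous d) ∧ f = ∑ i, (g i) ^ 2

/-- `f` is a sum of nonnegative circuit forms of degree `d` (SONC). -/
def IsSONC {n : ℕ} (d : ℕ) (f : MvPolynomial (Fin n) ℝ) : Prop :=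
  ∃ (k : ℕ) (h : Fin k → MvPolynomial (Fin n) ℝ),
    (∀ i, IsNonnegCircuit d (h i)) ∧ f = ∑ i, h i


namespace SosSonc
open Filter Topology

lemma closed_image {I Ω : Type*} (T : Set (I → Ω → ℝ)) (hT : IsClosed T)
    (Φ : (I → Ω → ℝ) → (Ω → ℝ)) (hΦ : Continuous Φ)
    (hb : ∀ t ∈ T, ∀ i x, |t i x| ≤ 1 + Φ t x) : IsClosed (Φ '' T) := by
  rw [isClosed_iff_ultrafilter]
  intro F u hu hmem
  have hsec : ∀ G : Ω → ℝ, ∃ t : I → Ω → ℝ, G ∈ Φ '' T → t ∈ T ∧ Φ t = G := by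
    intro G
    by_cases h : G ∈ Φ '' T
    · obtain ⟨t, ht⟩ := h
      exact ⟨t, fun _ => ht⟩
    · exact ⟨0, fun h' => absurd h' h⟩
  choose σ hσ using hsec
  have hev : ∀ᶠ G in (u : Filter (Ω → ℝ)), σ G ∈ T ∧ Φ (σ G) = G := by
    filter_upwards [hmem] with G hG using hσ G hG
  have hlim : ∀ i x, ∃ l : ℝ, Tendsto (fun G => σ G i x) u (𝓝 l) := by
    intro i x
    have h1 : Tendsto (fun G : Ω → ℝ => G x) u (𝓝 (F x)) :=
      ((continuous_apply x).tendsto F).mono_left hu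
    have h2 : ∀ᶠ G in (u : Filter (Ω → ℝ)), G x < F x + 1 :=
      h1.eventually (gt_mem_nhds (by linarith))
    have h3 : ∀ᶠ G in (u : Filter (Ω → ℝ)), σ G i x ∈ Set.Icc (-(F x + 2)) (F x + 2) := by
      filter_upwards [hev, h2] with G hG hG2
      have := hb _ hG.1 i x
      rw [hG.2] at this
      rw [Set.mem_Icc, ← abs_le]
      linarith
    obtain ⟨l, -, hl⟩ := (isCompact_Icc (a := -(F x + 2)) (b := F x + 2)).ultrafilter_le_nhds
      (u.map (fun G => σ G i x)) (by rw [le_principal_iff]; exact h3)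
    exact ⟨l, hl⟩
  choose l hl using hlim
  have ht : Tendsto σ u (𝓝 l) := by
    rw [tendsto_pi_nhds]
    intro i
    rw [tendsto_pi_nhds]
    exact hl i
  refine ⟨l, hT.mem_of_tendsto ht (hev.mono fun _ h => h.1), ?_⟩
  have h1 : Tendsto (fun G => Φ (σ G)) u (𝓝 (Φ l)) := (hΦ.tendsto l).comp ht
  have h2 : Tendsto (fun G => Φ (σ G)) u (𝓝 F) :=
    Tendsto.congr' (hev.mono fun G h => h.2.symm) hu
  exact tendsto_nhds_unique h1 h2

lemma sq_sum_reduce {k : ℕ} {E : Type*} [Fintype E] (C : Matrix (Fin k) E ℝ) :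
    ∃ B : Matrix E E ℝ, ∀ v : E → ℝ,
      ∑ i, (∑ e, C i e * v e) ^ 2 = ∑ j, (∑ e, B j e * v e) ^ 2 := by
  classical
  open scoped MatrixOrder in
  obtain ⟨B, hB⟩ := CStarAlgebra.nonneg_iff_eq_star_mul_self.mp
    (Matrix.posSemidef_conjTranspose_mul_self C).nonneg
  refine ⟨B, fun v => ?_⟩
  have key : ∀ {m : Type _} [Fintype m] (D : Matrix m E ℝ),
      ∑ i, (∑ e, D i e * v e) ^ 2 = v ⬝ᵥ ((D.conjTranspose * D).mulVec v) := by
    intro m _ D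
    rw [← Matrix.mulVec_mulVec, Matrix.dotProduct_mulVec, Matrix.conjTranspose_eq_transpose_of_trivial,
      Matrix.vecMul_transpose]
    simp [dotProduct, Matrix.mulVec, sq]
  have key2 : ∑ j, (∑ e, B j e * v e) ^ 2 = v ⬝ᵥ ((B.conjTranspose * B).mulVec v) := by
    rw [← Matrix.mulVec_mulVec, Matrix.dotProduct_mulVec, Matrix.conjTranspose_eq_transpose_of_trivial,
      Matrix.vecMul_transpose]
    simp [dotProduct, Matrix.mulVec, sq]
  rw [key C, key2, hB]
  rfl

lemma expToVec_inj {n : ℕ} : Function.Injective (expToVec (n := n)) := by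
  intro a b h
  ext i
  have := congrFun h i
  simpa [expToVec] using this

lemma sep {n : ℕ} (S : Finset (Fin n →₀ ℕ))
    (hS : AffineIndependent ℝ (fun a : {α : (Fin n →₀ ℕ) // α ∈ S} => expToVec a.1))
    (β : Fin n →₀ ℕ) (hβ : expToVec β ∈ intrinsicInterior ℝ (convexHull ℝ (expToVec '' (S : Set (Fin n →₀ ℕ)))))
    (a : Fin n →₀ ℕ) (ha : a ∈ S) :
    ∃ (w : Fin n → ℝ) (δ : ℝ), 0 < δ ∧ ∀ α ∈ S, α ≠ a →
      ∑ i, w i * (α i : ℝ) = ∑ i, w i * (β i : ℝ) - δ := by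
  have h1 : AffineIndependent ℝ (fun p => p : (expToVec '' (S : Set (Fin n →₀ ℕ))) → (Fin n → ℝ)) := by
    have := hS.range
    have hr : Set.range (fun a : {α : (Fin n →₀ ℕ) // α ∈ S} => expToVec a.1)
        = expToVec '' (S : Set (Fin n →₀ ℕ)) := by
      ext x; simp
    rw [hr] at this
    exact this
  obtain ⟨t, hst, hti, htop⟩ := exists_subset_affineIndependent_affineSpan_eq_top h1
  let b : AffineBasis t ℝ (Fin n → ℝ) := ⟨fun p => p, hti, by simpa using htop⟩
  have hat : expToVec a ∈ t := hst ⟨a, ha, rfl⟩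
  let ℓ := b.coord ⟨expToVec a, hat⟩
  have hℓa : ℓ (expToVec a) = 1 := b.coord_apply_eq ⟨expToVec a, hat⟩
  have hℓ0 : ∀ α ∈ S, α ≠ a → ℓ (expToVec α) = 0 := by
    intro α hα hne
    have : expToVec α ∈ t := hst ⟨α, hα, rfl⟩
    exact b.coord_apply_ne (i := ⟨expToVec a, hat⟩) (j := ⟨expToVec α, this⟩)
      (fun h => hne (expToVec_inj (congrArg Subtype.val h)).symm)
  have hpos : convexHull ℝ (expToVec '' (S : Set (Fin n →₀ ℕ))) ⊆ {x | 0 ≤ ℓ x} := by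
    apply convexHull_min
    · rintro _ ⟨α, hα, rfl⟩
      by_cases h : α = a
      · subst h; simp [hℓa]
      · simp [hℓ0 α hα h]
    · exact (convex_Ici (0 : ℝ)).affine_preimage ℓ
  have hβpos : 0 < ℓ (expToVec β) := by
    by_contra hneg
    push Not at hneg
    obtain ⟨y, hy, hyβ⟩ := mem_intrinsicInterior.1 hβ
    have haC : expToVec a ∈ affineSpan ℝ (convexHull ℝ (expToVec '' (S : Set (Fin n →₀ ℕ)))) :=
      subset_affineSpan ℝ _ (subset_convexHull ℝ _ ⟨a, ha, rfl⟩)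
    let γ : ℝ → affineSpan ℝ (convexHull ℝ (expToVec '' (S : Set (Fin n →₀ ℕ)))) :=
      fun s => ⟨AffineMap.lineMap (expToVec a) (y : Fin n → ℝ) s, AffineMap.lineMap_mem s haC y.2⟩
    have hγ : Continuous γ := Continuous.subtype_mk AffineMap.lineMap_continuous _
    have hγ1 : γ 1 = y := by apply Subtype.ext; simp [γ]
    have hnh : γ ⁻¹' (interior ((↑) ⁻¹' (convexHull ℝ (expToVec '' (S : Set (Fin n →₀ ℕ)))))) ∈ 𝓝 (1:ℝ) :=
      (isOpen_interior.preimage hγ).mem_nhds (by simpa [hγ1] using hy)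
    obtain ⟨ε, hε, hball⟩ := Metric.mem_nhds_iff.1 hnh
    have hm : (1 + ε / 2) ∈ Metric.ball (1:ℝ) ε := by
      rw [Metric.mem_ball, Real.dist_eq]
      rw [abs_of_pos] <;> linarith
    have h3 : γ (1 + ε / 2) ∈ _ := interior_subset (Set.mem_preimage.1 (hball hm))
    have h4 := hpos (Set.mem_preimage.1 h3)
    simp only [γ, Set.mem_ofPred_eq, AffineMap.apply_lineMap, hℓa, hyβ] at h4
    simp only [AffineMap.lineMap_apply, vsub_eq_sub, smul_eq_mul, vadd_eq_add] at h4
    nlinarith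
  refine ⟨fun i => ℓ.linear (Pi.single i 1), ℓ (expToVec β), hβpos, fun α hα hne => ?_⟩
  have hlin : ∀ α : Fin n →₀ ℕ, ∑ i, ℓ.linear (Pi.single i 1) * (α i : ℝ) = ℓ.linear (expToVec α) := by
    intro α
    conv_rhs => rw [pi_eq_sum_univ' (expToVec α)]
    rw [map_sum]
    refine Finset.sum_congr rfl fun i _ => ?_
    rw [map_smul, smul_eq_mul, mul_comm]
    rfl
  have h5 := ℓ.linearMap_vsub (expToVec α) (expToVec β)
  rw [hℓ0 α hα hne] at h5
  rw [hlin, hlin]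
  simp only [vsub_eq_sub, map_sub] at h5
  linarith

/-- Exponents of degree `m`. -/
noncomputable def Ex (n m : ℕ) : Finset (Fin n →₀ ℕ) := (Finsupp.finite_of_degree_eq m).toFinset

lemma mem_Ex {n m : ℕ} {α : Fin n →₀ ℕ} : α ∈ Ex n m ↔ α.degree = m := by
  simp [Ex]

/-- Evaluation as a linear map to functions. -/
noncomputable def ev (n : ℕ) : MvPolynomial (Fin n) ℝ →ₗ[ℝ] ((Fin n → ℝ) → ℝ) where
  toFun p := fun x => eval x p
  map_add' p q := by ext x; simp
  map_smul' a p := by ext x; simp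

lemma ev_apply {n : ℕ} (p : MvPolynomial (Fin n) ℝ) (x : Fin n → ℝ) : ev n p x = eval x p := rfl

/-- Polynomial with prescribed coefficients. -/
noncomputable def pol (n m : ℕ) : (Ex n m → ℝ) →ₗ[ℝ] MvPolynomial (Fin n) ℝ :=
  ∑ e : Ex n m, (monomial e.1).comp (LinearMap.proj e)

lemma pol_apply {n m : ℕ} (c : Ex n m → ℝ) : pol n m c = ∑ e : Ex n m, monomial e.1 (c e) := by
  simp [pol]

lemma coeff_pol {n m : ℕ} (c : Ex n m → ℝ) (e : Ex n m) : coeff e.1 (pol n m c) = c e := by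
  classical
  rw [pol_apply, coeff_sum]
  simp only [coeff_monomial]
  rw [Finset.sum_eq_single e]
  · simp
  · intro b _ hb
    rw [if_neg]
    exact fun h => hb (Subtype.ext h)
  · simp

lemma pol_hom {n m : ℕ} (c : Ex n m → ℝ) : (pol n m c).IsHomogeneous m := by
  rw [pol_apply]
  exact IsHomogeneous.sum _ _ _ fun e _ => isHomogeneous_monomial _ (mem_Ex.1 e.2)

lemma hom_ext {n m : ℕ} {p q : MvPolynomial (Fin n) ℝ} (hp : p.IsHomogeneous m)
    (hq : q.IsHomogeneous m) (h : ∀ α ∈ Ex n m, coeff α p = coeff α q) : p = q := by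
  ext α
  by_cases hα : α.degree = m
  · exact h α (mem_Ex.2 hα)
  · rw [hp.coeff_eq_zero hα, hq.coeff_eq_zero hα]

lemma pol_coeff {n m : ℕ} {p : MvPolynomial (Fin n) ℝ} (hp : p.IsHomogeneous m) :
    pol n m (fun e => coeff e.1 p) = p :=
  hom_ext (pol_hom _) hp fun α hα => coeff_pol _ ⟨α, hα⟩

/-- Coefficients to functions. -/
noncomputable def L (n m : ℕ) : (Ex n m → ℝ) →ₗ[ℝ] ((Fin n → ℝ) → ℝ) := (ev n).comp (pol n m)

lemma L_closed (n m : ℕ) : IsClosedEmbedding (L n m) := by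
  apply LinearMap.isClosedEmbedding_of_injective (𝕜 := ℝ)
  rw [LinearMap.ker_eq_bot']
  intro c hc
  have : pol n m c = 0 := by
    apply MvPolynomial.funext
    intro x
    have := congrFun hc x
    simpa [L, ev_apply] using this
  funext e
  rw [← coeff_pol c e, this]; simp

lemma L_apply {n m : ℕ} (c : Ex n m → ℝ) (x : Fin n → ℝ) :
    L n m c x = ∑ e, c e * eval x (monomial e.1 (1:ℝ)) := by
  rw [L, LinearMap.comp_apply, ev_apply, pol_apply, map_sum]
  refine Finset.sum_congr rfl fun e _ => ?_
  rw [eval_monomial, eval_monomial, one_mul]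

/-- The (closed) cone attached to a possible circuit. -/
def PCone {n : ℕ} (m : ℕ) (S : Finset (Fin n →₀ ℕ)) (β : Fin n →₀ ℕ)
    (p : MvPolynomial (Fin n) ℝ) : Prop :=
  p.IsHomogeneous m ∧ (∀ α, α ∉ S → α ≠ β → coeff α p = 0) ∧ (∀ α ∈ S, 0 ≤ coeff α p) ∧
    ∀ x, 0 ≤ eval x p

lemma PCone_closed {n : ℕ} (m : ℕ) (S : Finset (Fin n →₀ ℕ)) (β : Fin n →₀ ℕ) :
    IsClosed ((ev n) '' {p | PCone m S β p}) := by
  have : (ev n) '' {p | PCone m S β p} = L n m '' {c | (∀ e : Ex n m, e.1 ∉ S → e.1 ≠ β → c e = 0) ∧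
      (∀ e : Ex n m, e.1 ∈ S → 0 ≤ c e) ∧ ∀ x, 0 ≤ L n m c x} := by
    ext F
    constructor
    · rintro ⟨p, ⟨h1, h2, h3, h4⟩, rfl⟩
      refine ⟨fun e => coeff e.1 p, ⟨fun e => h2 e.1, fun e => h3 e.1, fun x => ?_⟩, ?_⟩
      · rw [L, LinearMap.comp_apply, pol_coeff h1]; exact h4 x
      · rw [L, LinearMap.comp_apply, pol_coeff h1]
    · rintro ⟨c, ⟨h2, h3, h4⟩, rfl⟩
      refine ⟨pol n m c, ⟨pol_hom c, ?_, ?_, h4⟩, rfl⟩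
      · intro α hS hβ
        by_cases hα : α ∈ Ex n m
        · rw [coeff_pol c ⟨α, hα⟩]; exact h2 ⟨α, hα⟩ hS hβ
        · exact (pol_hom c).coeff_eq_zero (fun h => hα (mem_Ex.2 h))
      · intro α hS
        by_cases hα : α ∈ Ex n m
        · rw [coeff_pol c ⟨α, hα⟩]; exact h3 ⟨α, hα⟩ hS
        · rw [(pol_hom c).coeff_eq_zero (fun h => hα (mem_Ex.2 h))]
  rw [this]
  apply (L_closed n m).isClosedMap
  have hc := (L_closed n m).continuous
  simp only [Set.ofPred_and, Set.ofPred_forall]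
  refine IsClosed.inter ?_ (IsClosed.inter ?_ ?_)
  · exact isClosed_iInter fun e => isClosed_iInter fun _ => isClosed_iInter fun _ =>
      isClosed_eq (continuous_apply e) continuous_const
  · exact isClosed_iInter fun e => isClosed_iInter fun _ =>
      isClosed_le continuous_const (continuous_apply e)
  · exact isClosed_iInter fun x => isClosed_le continuous_const ((continuous_apply x).comp hc)

lemma PCone_zero {n : ℕ} (m : ℕ) (S : Finset (Fin n →₀ ℕ)) (β : Fin n →₀ ℕ) : PCone m S β 0 :=
  ⟨isHomogeneous_zero _ _ _, by simp, by simp, by simp⟩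

lemma PCone_add {n : ℕ} {m : ℕ} {S : Finset (Fin n →₀ ℕ)} {β : Fin n →₀ ℕ}
    {p q : MvPolynomial (Fin n) ℝ} (hp : PCone m S β p) (hq : PCone m S β q) :
    PCone m S β (p + q) := by
  refine ⟨hp.1.add hq.1, fun α h1 h2 => ?_, fun α h => ?_, fun x => ?_⟩
  · rw [coeff_add, hp.2.1 α h1 h2, hq.2.1 α h1 h2, add_zero]
  · rw [coeff_add]; exact add_nonneg (hp.2.2.1 α h) (hq.2.2.1 α h)
  · rw [map_add]; exact add_nonneg (hp.2.2.2 x) (hq.2.2.2 x)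

lemma sonc_iff {n m : ℕ} {f : MvPolynomial (Fin n) ℝ} :
    IsSONC m f ↔ f ∈ AddSubmonoid.closure {h | IsNonnegCircuit m h} := by
  constructor
  · rintro ⟨k, h, hh, rfl⟩
    exact sum_mem fun i _ => AddSubmonoid.subset_closure (hh i)
  · intro hf
    obtain ⟨l, hl, rfl⟩ := AddSubmonoid.exists_list_of_mem_closure hf
    exact ⟨l.length, l.get, fun i => hl _ (List.get_mem _ _), by simp⟩

lemma sos_iff {n d : ℕ} {f : MvPolynomial (Fin n) ℝ} :
    IsSOSForm d f ↔ f ∈ AddSubmonoid.closure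
      {h | ∃ g : MvPolynomial (Fin n) ℝ, g.IsHomogeneous d ∧ g ^ 2 = h} := by
  constructor
  · rintro ⟨k, h, hh, rfl⟩
    exact sum_mem fun i _ => AddSubmonoid.subset_closure ⟨h i, hh i, rfl⟩
  · intro hf
    obtain ⟨l, hl, rfl⟩ := AddSubmonoid.exists_list_of_mem_closure hf
    choose g hg hg2 using hl
    refine ⟨l.length, fun i => g (l.get i) (List.get_mem _ _), fun i => hg _ _, ?_⟩
    simp only [hg2]
    simp

lemma circuit_smul {n m : ℕ} {h : MvPolynomial (Fin n) ℝ} (hh : IsNonnegCircuit m h) {a : ℝ}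
    (ha : 0 < a) : IsNonnegCircuit m (a • h) := by
  obtain ⟨h1, h2, S, h3, h4, h5⟩ := hh
  have hs : (a • h).support = h.support := by
    ext α; simp [ha.ne']
  refine ⟨?_, fun x => ?_, S, fun α hα => ⟨(h3 α hα).1, ?_⟩, h4, ?_⟩
  · exact (homogeneousSubmodule (Fin n) ℝ m).smul_mem a h1
  · rw [smul_eval]; exact mul_nonneg ha.le (h2 x)
  · rw [coeff_smul]; exact mul_pos ha (h3 α hα).2
  · rw [hs]; exact h5

lemma sonc_smul {n m : ℕ} {f : MvPolynomial (Fin n) ℝ} (hf : IsSONC m f) {a : ℝ}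
    (ha : 0 ≤ a) : IsSONC m (a • f) := by
  rcases ha.eq_or_lt with rfl | ha
  · exact ⟨0, Fin.elim0, fun i => i.elim0, by simp⟩
  · obtain ⟨k, h, hh, rfl⟩ := hf
    exact ⟨k, fun i => a • h i, fun i => circuit_smul (hh i) ha, Finset.smul_sum⟩

lemma sos_smul {n m : ℕ} {f : MvPolynomial (Fin n) ℝ} (hf : IsSOSForm m f) {a : ℝ}
    (ha : 0 ≤ a) : IsSOSForm m (a • f) := by
  obtain ⟨k, h, hh, rfl⟩ := hf
  refine ⟨k, fun i => Real.sqrt a • h i, fun i =>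
    (homogeneousSubmodule (Fin n) ℝ m).smul_mem _ (hh i), ?_⟩
  simp only [smul_pow, Real.sq_sqrt ha, Finset.smul_sum]

lemma sonc_add {n m : ℕ} {f g : MvPolynomial (Fin n) ℝ} (hf : IsSONC m f) (hg : IsSONC m g) :
    IsSONC m (f + g) := by
  rw [sonc_iff] at *; exact add_mem hf hg

lemma sos_add {n m : ℕ} {f g : MvPolynomial (Fin n) ℝ} (hf : IsSOSForm m f)
    (hg : IsSOSForm m g) : IsSOSForm m (f + g) := by
  rw [sos_iff] at *; exact add_mem hf hg

lemma sonc_zero {n m : ℕ} : IsSONC m (0 : MvPolynomial (Fin n) ℝ) :=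
  ⟨0, Fin.elim0, fun i => i.elim0, by simp⟩

lemma sos_nonneg {n m : ℕ} {f : MvPolynomial (Fin n) ℝ} (hf : IsSOSForm m f) (x : Fin n → ℝ) :
    0 ≤ eval x f := by
  obtain ⟨k, h, hh, rfl⟩ := hf
  rw [map_sum]
  exact Finset.sum_nonneg fun i _ => by rw [map_pow]; positivity

lemma sonc_nonneg {n m : ℕ} {f : MvPolynomial (Fin n) ℝ} (hf : IsSONC m f) (x : Fin n → ℝ) :
    0 ≤ eval x f := by
  obtain ⟨k, h, hh, rfl⟩ := hf
  rw [map_sum]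
  exact Finset.sum_nonneg fun i _ => (hh i).2.1 x

/-- Admissible pairs. -/
def Valid {n : ℕ} (m : ℕ) (s : Finset (Fin n →₀ ℕ) × (Fin n →₀ ℕ)) : Prop :=
  s.1 ⊆ Ex n m ∧ s.2 ∈ Ex n m ∧ (∀ α ∈ s.1, ∀ i, Even (α i)) ∧
  AffineIndependent ℝ (fun a : {α : (Fin n →₀ ℕ) // α ∈ s.1} => expToVec a.1) ∧
  (s.2 ∈ s.1 ∨ s.2 ∉ s.1 ∧
    expToVec s.2 ∈ intrinsicInterior ℝ (convexHull ℝ (expToVec '' (s.1 : Set (Fin n →₀ ℕ)))))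

lemma valid_finite (n m : ℕ) : {s : Finset (Fin n →₀ ℕ) × (Fin n →₀ ℕ) | Valid m s}.Finite := by
  refine Set.Finite.subset ((Ex n m).powerset ×ˢ (Ex n m)).finite_toSet ?_
  intro s hs
  simp only [Finset.coe_product, Set.mem_prod, Finset.mem_coe, Finset.mem_powerset]
  exact ⟨hs.1, hs.2.1⟩

lemma circuit_mem {n m : ℕ} {h : MvPolynomial (Fin n) ℝ} (hh : IsNonnegCircuit m h) :
    h = 0 ∨ ∃ s, Valid m s ∧ PCone m s.1 s.2 h := by
  obtain ⟨h1, h2, S, h3, h4, h5⟩ := hh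
  by_cases h0 : h = 0
  · exact Or.inl h0
  right
  have hsub : S ⊆ Ex n m := by
    intro α hα
    by_contra hne
    have := (h3 α hα).2
    rw [h1.coeff_eq_zero (fun h => hne (mem_Ex.2 h))] at this
    exact lt_irrefl _ this
  rcases h5 with h5 | ⟨β, hβ, h5, h6⟩
  · have hne : h.support.Nonempty := by
      rw [Finset.nonempty_iff_ne_empty]; simpa using h0
    obtain ⟨β, hβ⟩ := hne
    have hβS : β ∈ S := by rw [Finset.coe_inj.1 h5] at hβ; exact hβ
    refine ⟨(S, β), ⟨hsub, hsub hβS, fun α hα => (h3 α hα).1, h4, Or.inl hβS⟩,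
      h1, fun α hα _ => ?_, fun α hα => (h3 α hα).2.le, h2⟩
    rw [← Finset.coe_inj.1 h5] at hα
    simpa using hα
  · have hβs : β ∈ h.support := by
      rw [← Finset.mem_coe, h5]; simp
    refine ⟨(S, β), ⟨hsub, mem_Ex.2 ?_, fun α hα => (h3 α hα).1, h4, Or.inr ⟨hβ, h6⟩⟩,
      h1, fun α hα hαβ => ?_, fun α hα => (h3 α hα).2.le, h2⟩
    · by_contra hne
      exact (mem_support_iff.1 hβs) (h1.coeff_eq_zero hne)
    · by_contra hne
      have : α ∈ (h.support : Set (Fin n →₀ ℕ)) := by simpa using hne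
      rw [h5] at this
      rcases this with h | h
      · exact hαβ h
      · exact hα h

lemma even_monomial_nonneg {n : ℕ} {α : Fin n →₀ ℕ} (hα : ∀ i, Even (α i)) {c : ℝ} (hc : 0 ≤ c)
    (x : Fin n → ℝ) : 0 ≤ eval x (monomial α c) := by
  rw [eval_monomial]
  exact mul_nonneg hc (Finset.prod_nonneg fun i _ => (hα i).pow_nonneg _)

lemma monomial_sonc {n m : ℕ} {α : Fin n →₀ ℕ} (hα : ∀ i, Even (α i)) (hd : α.degree = m)
    {c : ℝ} (hc : 0 ≤ c) : IsSONC m (monomial α c) := by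
  classical
  rcases hc.eq_or_lt with rfl | hc
  · simpa using sonc_zero
  rw [sonc_iff]
  apply AddSubmonoid.subset_closure
  refine ⟨isHomogeneous_monomial _ hd, even_monomial_nonneg hα hc.le, {α}, ?_, ?_, Or.inl ?_⟩
  · simpa [hc] using hα
  · have : Subsingleton {a : Fin n →₀ ℕ // a ∈ ({α} : Finset (Fin n →₀ ℕ))} :=
      ⟨fun a b => Subtype.ext ((Finset.mem_singleton.1 a.2).trans (Finset.mem_singleton.1 b.2).symm)⟩
    exact affineIndependent_of_subsingleton ℝ _
  · rw [support_monomial, if_neg hc.ne']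

lemma even_sonc {n m : ℕ} {p : MvPolynomial (Fin n) ℝ} (hp : p.IsHomogeneous m)
    (h : ∀ α ∈ p.support, (∀ i, Even (α i)) ∧ 0 ≤ coeff α p) : IsSONC m p := by
  rw [sonc_iff, p.as_sum]
  refine sum_mem fun α hα => sonc_iff.1 (monomial_sonc (h α hα).1 ?_ (h α hα).2)
  by_contra hne
  exact (mem_support_iff.1 hα) (hp.coeff_eq_zero hne)

lemma outer_pos {n m : ℕ} {S : Finset (Fin n →₀ ℕ)} {β : Fin n →₀ ℕ} {p : MvPolynomial (Fin n) ℝ}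
    (hp : PCone m S β p) (heven : ∀ α ∈ S, ∀ i, Even (α i))
    (hS : AffineIndependent ℝ (fun a : {α : (Fin n →₀ ℕ) // α ∈ S} => expToVec a.1))
    (hβS : β ∉ S)
    (hβ : expToVec β ∈ intrinsicInterior ℝ (convexHull ℝ (expToVec '' (S : Set (Fin n →₀ ℕ)))))
    (hb : coeff β p ≠ 0) (hsign : coeff β p < 0 ∨ ∃ i, ¬ Even (β i)) :
    ∀ α ∈ S, 0 < coeff α p := by
  classical
  intro a ha
  by_contra hneg
  have ha0 : coeff a p = 0 := le_antisymm (not_lt.1 hneg) (hp.2.2.1 a ha)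
  obtain ⟨w, δ, hδ, hw⟩ := sep S hS β hβ a ha
  obtain ⟨σ, hσ, hm⟩ : ∃ σ : Fin n → ℝ, (∀ i, σ i = 1 ∨ σ i = -1) ∧
      coeff β p * ∏ i, σ i ^ β i < 0 := by
    by_cases hneg : coeff β p < 0
    · exact ⟨fun _ => 1, fun _ => Or.inl rfl, by simpa using hneg⟩
    · obtain ⟨j, hj⟩ := hsign.resolve_left hneg
      have hpos : 0 < coeff β p := lt_of_le_of_ne (not_lt.1 hneg) hb.symm
      refine ⟨fun i => if i = j then -1 else 1, fun i => ?_, ?_⟩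
      · by_cases h : i = j <;> simp [h]
      · rw [Finset.prod_eq_single j]
        · simp only [if_true]
          rw [(Nat.not_even_iff_odd.1 hj).neg_one_pow]; linarith
        · intro i _ hi; simp [hi]
        · simp
  set μ := coeff β p * ∏ i, σ i ^ β i with hμ
  set A := ∑ α ∈ S.erase a, coeff α p with hA
  set W := ∑ i, w i * (β i : ℝ) with hW
  have heval : ∀ s : ℝ, eval (fun i => σ i * Real.exp (s * w i)) p
      = μ * Real.exp (s * W) + A * Real.exp (s * (W - δ)) := by
    intro s
    have hprod : ∀ α : Fin n →₀ ℕ, ∏ i, (σ i * Real.exp (s * w i)) ^ α i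
        = (∏ i, σ i ^ α i) * Real.exp (s * ∑ i, w i * (α i : ℝ)) := by
      intro α
      rw [Finset.mul_sum, Real.exp_sum, ← Finset.prod_mul_distrib]
      refine Finset.prod_congr rfl fun i _ => ?_
      rw [mul_pow, ← Real.exp_nat_mul]
      congr 2; ring
    rw [eval_eq']
    have hsub : p.support ⊆ insert β (S.erase a) := by
      intro α hα
      rw [mem_support_iff] at hα
      rw [Finset.mem_insert, Finset.mem_erase]
      by_cases h : α = β
      · exact Or.inl h
      · right
        refine ⟨fun h => hα (h ▸ ha0), ?_⟩
        by_contra h'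
        exact hα (hp.2.1 α h' h)
    rw [Finset.sum_subset hsub (fun α _ h => by rw [notMem_support_iff.1 h, zero_mul]),
      Finset.sum_insert (fun h => hβS (Finset.mem_of_mem_erase h)), hprod, ← mul_assoc, hA,
      Finset.sum_mul]
    congr 1
    refine Finset.sum_congr rfl fun α hα => ?_
    rw [Finset.mem_erase] at hα
    rw [hprod, hw α hα.2 hα.1]
    have : ∏ i, σ i ^ α i = 1 := Finset.prod_eq_one fun i _ => by
      rcases hσ i with h | h
      · rw [h, one_pow]
      · rw [h, (heven α hα.2 i).neg_one_pow]
    rw [this, one_mul]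
  have h1 := hp.2.2.2 (fun i => σ i * Real.exp ((A / (-μ) / δ) * w i))
  rw [heval] at h1
  set s := A / (-μ) / δ with hs
  have h2 : Real.exp (s * W) = Real.exp (s * (W - δ)) * Real.exp (A / (-μ)) := by
    rw [← Real.exp_add]
    congr 1
    have : s * δ = A / (-μ) := by rw [hs]; field_simp
    linarith
  have h3 := Real.add_one_le_exp (A / (-μ))
  have h4 : (-μ) * (A / (-μ)) = A := by
    have : -μ ≠ 0 := by linarith
    exact mul_div_cancel₀ A this
  have h5 := Real.exp_pos (s * (W - δ))
  have h6 : μ * Real.exp (A / (-μ)) + A < 0 := by nlinarith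
  rw [h2] at h1
  nlinarith

lemma pcone_sonc {n m : ℕ} {s : Finset (Fin n →₀ ℕ) × (Fin n →₀ ℕ)} (hs : Valid m s)
    {p : MvPolynomial (Fin n) ℝ} (hp : PCone m s.1 s.2 p) : IsSONC m p := by
  obtain ⟨S, β⟩ := s
  obtain ⟨h1, h2, h3, h4, h5⟩ := hs
  simp only at *
  by_cases hgood : ∀ α ∈ p.support, (∀ i, Even (α i)) ∧ 0 ≤ coeff α p
  · exact even_sonc hp.1 hgood
  push Not at hgood
  obtain ⟨α, hα, hbad⟩ := hgood
  have hαS : α ∉ S := fun h => absurd (hbad (h3 α h)) (not_lt.2 (hp.2.2.1 α h))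
  have hαβ : α = β := by
    by_contra h
    exact (mem_support_iff.1 hα) (hp.2.1 α hαS h)
  subst hαβ
  have h6 := (h5.resolve_left hαS).2
  have hsign : coeff α p < 0 ∨ ∃ i, ¬ Even (α i) := by
    by_cases h : ∀ i, Even (α i)
    · exact Or.inl (hbad h)
    · exact Or.inr (not_forall.1 h)
  have hpos := outer_pos hp h3 h4 hαS h6 (mem_support_iff.1 hα) hsign
  rw [sonc_iff]
  refine AddSubmonoid.subset_closure ⟨hp.1, hp.2.2.2, S, fun γ hγ => ⟨h3 γ hγ, hpos γ hγ⟩, h4,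
    Or.inr ⟨α, hαS, ?_, h6⟩⟩
  ext γ
  rw [Set.mem_insert_iff, Finset.mem_coe, Finset.mem_coe, mem_support_iff]
  constructor
  · intro h
    by_contra hcon
    push Not at hcon
    exact h (hp.2.1 γ hcon.2 hcon.1)
  · rintro (rfl | h)
    · exact mem_support_iff.1 hα
    · exact (hpos γ h).ne'

lemma sonc_decomp {n m : ℕ} [Fintype {s : Finset (Fin n →₀ ℕ) × (Fin n →₀ ℕ) // Valid m s}]
    {f : MvPolynomial (Fin n) ℝ} (hf : IsSONC m f) :
    ∃ q : {s : Finset (Fin n →₀ ℕ) × (Fin n →₀ ℕ) // Valid m s} → MvPolynomial (Fin n) ℝ,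
      (∀ s, PCone m s.1.1 s.1.2 (q s)) ∧ f = ∑ s, q s := by
  classical
  rw [sonc_iff] at hf
  induction hf using AddSubmonoid.closure_induction with
  | mem h hh =>
    rcases circuit_mem hh with rfl | ⟨s, hs, hp⟩
    · exact ⟨fun _ => 0, fun s => PCone_zero _ _ _, by simp⟩
    · refine ⟨Pi.single ⟨s, hs⟩ h, fun t => ?_, by simp⟩
      by_cases ht : t = ⟨s, hs⟩
      · subst ht; simpa using hp
      · rw [Pi.single_eq_of_ne ht]; exact PCone_zero _ _ _
  | zero => exact ⟨fun _ => 0, fun s => PCone_zero _ _ _, by simp⟩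
  | add f g _ _ hf hg =>
    obtain ⟨q, hq, rfl⟩ := hf
    obtain ⟨r, hr, rfl⟩ := hg
    exact ⟨fun s => q s + r s, fun s => PCone_add (hq s) (hr s), Finset.sum_add_distrib.symm⟩

lemma sos_decomp {n d : ℕ} {f : MvPolynomial (Fin n) ℝ} (hf : IsSOSForm d f) :
    ∃ B : Ex n d → (Ex n d → ℝ), ∀ x, eval x f = ∑ j, (L n d (B j) x) ^ 2 := by
  obtain ⟨k, g, hg, rfl⟩ := hf
  obtain ⟨B, hB⟩ := sq_sum_reduce (fun i (e : Ex n d) => coeff e.1 (g i))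
  refine ⟨B, fun x => ?_⟩
  have := hB (fun e => eval x (monomial e.1 (1:ℝ)))
  simp only [L_apply]
  rw [← this, map_sum]
  refine Finset.sum_congr rfl fun i _ => ?_
  rw [map_pow, ← L_apply (fun e : Ex n d => coeff e.1 (g i)) x, L, LinearMap.comp_apply,
    pol_coeff (hg i), ev_apply]

/-- The set of functions in question. -/
def SCset (n d : ℕ) : Set ((Fin n → ℝ) → ℝ) := {F | ∃ p : MvPolynomial (Fin n) ℝ,
      (∃ g c : MvPolynomial (Fin n) ℝ, IsSOSForm d g ∧ IsSONC (2 * d) c ∧ p = g + c) ∧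
      F = fun x => eval x p}

lemma SC_closed (n d : ℕ) : IsClosed (SCset n d) := by
  classical
  let J := {s : Finset (Fin n →₀ ℕ) × (Fin n →₀ ℕ) // Valid (2 * d) s}
  have : Fintype J := (valid_finite n (2 * d)).fintype
  let T : Set ((Ex n d ⊕ J) → (Fin n → ℝ) → ℝ) :=
    {t | (∀ j, t (Sum.inl j) ∈ Set.range (L n d)) ∧
      ∀ s : J, t (Sum.inr s) ∈ (ev n) '' {p | PCone (2 * d) s.1.1 s.1.2 p}}
  let Φ : ((Ex n d ⊕ J) → (Fin n → ℝ) → ℝ) → ((Fin n → ℝ) → ℝ) :=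
    fun t x => ∑ j, (t (Sum.inl j) x) ^ 2 + ∑ s, t (Sum.inr s) x
  have hT : IsClosed T := by
    have h1 : IsClosed {t : (Ex n d ⊕ J) → (Fin n → ℝ) → ℝ |
        ∀ j, t (Sum.inl j) ∈ Set.range (L n d)} := by
      rw [Set.ofPred_forall]
      exact isClosed_iInter fun j => (L_closed n d).isClosed_range.preimage (continuous_apply _)
    have h2 : IsClosed {t : (Ex n d ⊕ J) → (Fin n → ℝ) → ℝ |
        ∀ s : J, t (Sum.inr s) ∈ (ev n) '' {p | PCone (2 * d) s.1.1 s.1.2 p}} := by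
      rw [Set.ofPred_forall]
      exact isClosed_iInter fun s => (PCone_closed _ _ _).preimage (continuous_apply _)
    exact h1.inter h2
  have hΦ : Continuous Φ := by
    refine continuous_pi fun x => ?_
    refine Continuous.add ?_ ?_
    · exact continuous_finsetSum _ fun j _ =>
        ((continuous_apply x).comp (continuous_apply (Sum.inl j))).pow 2
    · exact continuous_finsetSum _ fun s _ =>
        (continuous_apply x).comp (continuous_apply (Sum.inr s))
  have hb : ∀ t ∈ T, ∀ i x, |t i x| ≤ 1 + Φ t x := by
    intro t ht i x
    have hn : ∀ s : J, 0 ≤ t (Sum.inr s) x := by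
      intro s
      obtain ⟨p, hp, hpe⟩ := ht.2 s
      rw [← hpe]; exact hp.2.2.2 x
    have hA : 0 ≤ ∑ j, (t (Sum.inl j) x) ^ 2 := Finset.sum_nonneg fun j _ => sq_nonneg _
    have hB : 0 ≤ ∑ s : J, t (Sum.inr s) x := Finset.sum_nonneg fun s _ => hn s
    rcases i with j | s
    · have := Finset.single_le_sum (f := fun j => (t (Sum.inl j) x) ^ 2)
        (fun j _ => sq_nonneg _) (Finset.mem_univ j)
      have h3 : |t (Sum.inl j) x| ≤ 1 + (t (Sum.inl j) x) ^ 2 := by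
        rw [← sq_abs]; nlinarith [sq_nonneg (|t (Sum.inl j) x| - 1), abs_nonneg (t (Sum.inl j) x)]
      simp only [Φ]; linarith
    · have := Finset.single_le_sum (f := fun s : J => t (Sum.inr s) x)
        (fun s _ => hn s) (Finset.mem_univ s)
      rw [abs_of_nonneg (hn s)]
      simp only [Φ]; linarith
  have key : SCset n d = Φ '' T := by
    ext F
    constructor
    · rintro ⟨p, ⟨g, c, hg, hc, rfl⟩, rfl⟩
      obtain ⟨B, hB⟩ := sos_decomp hg
      obtain ⟨q, hq, rfl⟩ := sonc_decomp hc
      refine ⟨Sum.elim (fun j => L n d (B j)) (fun s => ev n (q s)),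
        ⟨fun j => ⟨B j, rfl⟩, fun s => ⟨q s, hq s, rfl⟩⟩, ?_⟩
      funext x
      simp [Φ, hB, ev_apply, J]
    · rintro ⟨t, ⟨h1, h2⟩, rfl⟩
      choose B hB using h1
      choose q hq hqe using h2
      refine ⟨_, ⟨∑ j, (pol n d (B j)) ^ 2, ∑ s, q s, ?_, ?_, rfl⟩, ?_⟩
      · rw [sos_iff]
        exact sum_mem fun j _ => AddSubmonoid.subset_closure ⟨_, pol_hom _, rfl⟩
      · rw [sonc_iff]
        exact sum_mem fun s _ => sonc_iff.1 (pcone_sonc s.2 (hq s))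
      · funext x
        simp only [Φ, ← hB, ← hqe, map_add, map_sum, map_pow, ev_apply, L, LinearMap.comp_apply]
  rw [key]
  exact closed_image T hT Φ hΦ hb

lemma sq_mem {n d : ℕ} {g : MvPolynomial (Fin n) ℝ} (hg : g.IsHomogeneous d) :
    ev n (g ^ 2) ∈ SCset n d :=
  ⟨g ^ 2, ⟨g ^ 2, 0, ⟨1, fun _ => g, fun _ => hg, by simp⟩, sonc_zero, by simp⟩, rfl⟩

lemma SC_span {n d : ℕ} {p : MvPolynomial (Fin n) ℝ} (hp : p.IsHomogeneous (2 * d)) :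
    ev n p ∈ Submodule.span ℝ (SCset n d) := by
  rw [p.as_sum, map_sum]
  refine sum_mem fun γ hγ => ?_
  have hdeg : γ.degree = 2 * d := by
    by_contra hne
    exact (mem_support_iff.1 hγ) (hp.coeff_eq_zero hne)
  obtain ⟨α, hle, hα⟩ := Finsupp.exists_le_degree_eq γ d (by omega)
  obtain ⟨β, rfl⟩ := exists_add_of_le hle
  have hβ : β.degree = d := by
    rw [map_add] at hdeg; omega
  have ha := isHomogeneous_monomial (1 : ℝ) hα
  have hb := isHomogeneous_monomial (1 : ℝ) hβ
  have hid : monomial (α + β) (coeff (α + β) p) = (coeff (α + β) p / 4) •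
      ((monomial α (1:ℝ) + monomial β 1) ^ 2 - (monomial α (1:ℝ) - monomial β 1) ^ 2) := by
    have : (monomial α (1:ℝ) + monomial β 1) ^ 2 - (monomial α (1:ℝ) - monomial β 1) ^ 2
        = (4 : ℝ) • monomial (α + β) 1 := by
      have h1 : monomial (α + β) (1:ℝ) = monomial α 1 * monomial β 1 := by
        rw [monomial_mul, one_mul]
      rw [h1, smul_eq_C_mul, show (C (4:ℝ) : MvPolynomial (Fin n) ℝ) = 4 from map_ofNat C 4]; ring
    rw [this, smul_smul, smul_monomial]
    simp
  rw [hid, map_smul, map_sub]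
  exact Submodule.smul_mem _ _ (Submodule.sub_mem _
    (Submodule.subset_span (sq_mem (ha.add hb))) (Submodule.subset_span (sq_mem (ha.sub hb))))

end SosSonc

/-- The SOS+SONC cone `(Σ+C)_{n,2d}` is a proper cone in `H_{n,2d}`: viewing forms as
polynomial functions, the set of SOS+SONC forms of degree `2d` is a convex cone which
is closed, pointed, and solid in `H_{n,2d}` (i.e. its linear span contains every
form of degree `2d`, which for a closed convex pointed cone in the finite-dimensional
space `H_{n,2d}` is equivalent to having nonempty interior there). -/
theorem sos_plus_sonc_proper_cone (n d : ℕ) (SC : Set ((Fin n → ℝ) → ℝ))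
    (hSC : SC = {F | ∃ p : MvPolynomial (Fin n) ℝ,
      (∃ g c : MvPolynomial (Fin n) ℝ, IsSOSForm d g ∧ IsSONC (2 * d) c ∧ p = g + c) ∧
      F = fun x => eval x p}) :
    (∀ F ∈ SC, ∀ G ∈ SC, ∀ a b : ℝ, 0 ≤ a → 0 ≤ b → a • F + b • G ∈ SC) ∧
    IsClosed SC ∧
    (∀ F ∈ SC, -F ∈ SC → F = 0) ∧
    (∀ p : MvPolynomial (Fin n) ℝ, p.IsHomogeneous (2 * d) →
      (fun x => eval x p) ∈ Submodule.span ℝ SC) := by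

  have hSC' : SC = SosSonc.SCset n d := hSC
  have hnn : ∀ F ∈ SC, ∀ x, 0 ≤ F x := by
    intro F hF x
    rw [hSC] at hF
    obtain ⟨p, ⟨g, c, hg, hc, rfl⟩, rfl⟩ := hF
    simp only [map_add]
    exact add_nonneg (SosSonc.sos_nonneg hg x) (SosSonc.sonc_nonneg hc x)
  refine ⟨?_, ?_, ?_, ?_⟩
  · intro F hF G hG a b ha hb
    rw [hSC] at hF hG ⊢
    obtain ⟨p, ⟨g, c, hg, hc, rfl⟩, rfl⟩ := hF
    obtain ⟨q, ⟨g', c', hg', hc', rfl⟩, rfl⟩ := hG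
    refine ⟨_, ⟨a • g + b • g', a • c + b • c',
      SosSonc.sos_add (SosSonc.sos_smul hg ha) (SosSonc.sos_smul hg' hb),
      SosSonc.sonc_add (SosSonc.sonc_smul hc ha) (SosSonc.sonc_smul hc' hb), rfl⟩, ?_⟩
    funext x
    simp only [Pi.add_apply, Pi.smul_apply, smul_eq_mul, map_add, smul_eval]
    ring
  · rw [hSC']; exact SosSonc.SC_closed n d
  · intro F hF hF'
    funext x
    have h1 := hnn F hF x
    have h2 := hnn _ hF' x
    simp only [Pi.neg_apply] at h2
    simp only [Pi.zero_apply]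
    linarith
  · intro p hp
    rw [hSC']
    exact SosSonc.SC_span hp
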